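/- Assume d·θ² ≤ 1. For any ε > 0 there exists a constant δ = δ(π, ε) > 0 such that for all n, if x_n < δ then |x_{n+1} − d·θ²·x_n| ≤ ε·x_n. -/

import Mathlib

open Finset Filter

namespace AsymIsing

/-- Level-`k` vertices of the rooted `d`-ary tree: paths of length `k` from the root. -/
abbrev Vert (d k : ℕ) : Type := Fin k → Fin d

/-- A spin configuration on levels `0, …, n` of the `d`-ary tree. -/
abbrev Conf (d n : ℕ) : Type := ∀ k : Fin (n + 1), Vert d k → Fin 2

/-- A spin configuration on level `n` only. -/
abbrev LConf (d n : ℕ) : Type := Vert d n → Fin 2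

/-- The transition matrix of the asymmetric binary channel; the paper's state `1`
corresponds to the index `0` and the state `2` to the index `1`. -/
noncomputable def Mmat (θ Δ : ℝ) : Fin 2 → Fin 2 → ℝ := fun i j =>
  if i = 0 then (if j = 0 then (1 + θ - Δ) / 2 else (1 - θ + Δ) / 2)
  else (if j = 0 then (1 - θ - Δ) / 2 else (1 + θ + Δ) / 2)

/-- The stationary distribution `π = (π₁, π₂)` of the channel. -/
noncomputable def pst (θ Δ : ℝ) : Fin 2 → ℝ := fun i =>
  if i = 0 then 1 / 2 - Δ / (2 * (1 - θ)) else 1 / 2 + Δ / (2 * (1 - θ))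

/-- The root spin of a configuration. -/
def root {d n : ℕ} (σ : Conf d n) : Fin 2 := σ ⟨0, n.succ_pos⟩ (fun i => i.elim0)

/-- The restriction of a configuration to the last (`n`-th) level. -/
def top {d n : ℕ} (σ : Conf d n) : LConf d n := σ (Fin.last n)

/-- The probability of a full configuration on levels `0, …, n` under the broadcast
process: the root is drawn from `π` and spins propagate along edges via `M`. -/
noncomputable def confProb (d : ℕ) (θ Δ : ℝ) (n : ℕ) (σ : Conf d n) : ℝ :=
  pst θ Δ (root σ) *
    ∏ k : Fin n, ∏ v : Vert d (k + 1),
      Mmat θ Δ (σ k.castSucc (v ∘ Fin.castSucc)) (σ k.succ v)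

/-- `P(σ(n) = A)`: the marginal law of the level-`n` spins. -/
noncomputable def levelProb (d : ℕ) (θ Δ : ℝ) (n : ℕ) (A : LConf d n) : ℝ :=
  ∑ σ : Conf d n, if top σ = A then confProb d θ Δ n σ else 0

/-- `P(σ_ρ = i, σ(n) = A)`. -/
noncomputable def jointProb (d : ℕ) (θ Δ : ℝ) (n : ℕ) (i : Fin 2) (A : LConf d n) : ℝ :=
  ∑ σ : Conf d n, if root σ = i ∧ top σ = A then confProb d θ Δ n σ else 0

/-- The posterior `f_n(i, A) = P(σ_ρ = i ∣ σ(n) = A)`. -/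
noncomputable def post (d : ℕ) (θ Δ : ℝ) (n : ℕ) (i : Fin 2) (A : LConf d n) : ℝ :=
  jointProb d θ Δ n i A / levelProb d θ Δ n A

/-- The law of `σ^i(n)`, i.e. `P(σ(n) = A ∣ σ_ρ = i)`. -/
noncomputable def condLevel (d : ℕ) (θ Δ : ℝ) (n : ℕ) (i : Fin 2) (A : LConf d n) : ℝ :=
  jointProb d θ Δ n i A / pst θ Δ i

/-- The total variation distance between `σ^1(n)` and `σ^2(n)`. -/
noncomputable def tvDist (d : ℕ) (θ Δ : ℝ) (n : ℕ) : ℝ :=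
  (1 / 2) * ∑ A : LConf d n, |condLevel d θ Δ n 0 A - condLevel d θ Δ n 1 A|

/-- The reconstruction problem is solvable if `limsup_n d_TV(σ^1(n), σ^2(n)) > 0`. -/
def solvable (d : ℕ) (θ Δ : ℝ) : Prop :=
  0 < Filter.limsup (fun n => tvDist d θ Δ n) Filter.atTop

/-- Non-reconstruction: `limsup_n d_TV(σ^1(n), σ^2(n)) = 0`. -/
def nonReconstruction (d : ℕ) (θ Δ : ℝ) : Prop :=
  Filter.limsup (fun n => tvDist d θ Δ n) Filter.atTop = 0

/-- Expectation of a function of the level-`n` configuration, conditioned on `σ_ρ = 1`. -/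
noncomputable def expect1 (d : ℕ) (θ Δ : ℝ) (n : ℕ) (g : LConf d n → ℝ) : ℝ :=
  ∑ A : LConf d n, condLevel d θ Δ n 0 A * g A

/-- `x_n = E f_n(1, σ^1(n)) − π₁`. -/
noncomputable def xseq (d : ℕ) (θ Δ : ℝ) (n : ℕ) : ℝ :=
  expect1 d θ Δ n (fun A => post d θ Δ n 0 A) - pst θ Δ 0

/-- `z_n = E (f_n(1, σ^1(n)) − π₁)²`. -/
noncomputable def zseq (d : ℕ) (θ Δ : ℝ) (n : ℕ) : ℝ :=
  expect1 d θ Δ n (fun A => (post d θ Δ n 0 A - pst θ Δ 0) ^ 2)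

/-- The restriction of a level-`(n+1)` configuration to the subtree of the `j`-th
child of the root (paths starting with `j`). -/
def restrictChild {d n : ℕ} (j : Fin d) (A : LConf d (n + 1)) : LConf d n :=
  fun w => A (Fin.cons j w)

/-- `Y_j = f_n(1, σ_j(n+1))`, as a function of the level-`(n+1)` configuration. -/
noncomputable def Yfun (d : ℕ) (θ Δ : ℝ) (n : ℕ) (j : Fin d) (A : LConf d (n + 1)) : ℝ :=
  post d θ Δ n 0 (restrictChild j A)

/-- `Z₁ = ∏_j (1 + (θ/π₁)(Y_j − π₁))`, as a function of the level-`(n+1)` configuration. -/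
noncomputable def Z1fun (d : ℕ) (θ Δ : ℝ) (n : ℕ) (A : LConf d (n + 1)) : ℝ :=
  ∏ j : Fin d, (1 + (θ / pst θ Δ 0) * (Yfun d θ Δ n j A - pst θ Δ 0))

/-- `Z₂ = ∏_j (1 − (θ/π₂)(Y_j − π₁))`, as a function of the level-`(n+1)` configuration. -/
noncomputable def Z2fun (d : ℕ) (θ Δ : ℝ) (n : ℕ) (A : LConf d (n + 1)) : ℝ :=
  ∏ j : Fin d, (1 - (θ / pst θ Δ 1) * (Yfun d θ Δ n j A - pst θ Δ 0))

/-- The value of `Δ` making `π = (π₁, π₂)` the stationary distribution of the channel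
with second eigenvalue `θ`, namely `Δ = (1 − θ)(π₂ − π₁)`. -/
noncomputable def Dlt (θ π1 π2 : ℝ) : ℝ := (1 - θ) * (π2 - π1)

/-- The Gaussian-approximation function
`f(s) = E[π₁ e^{sμ₁+√s W₁} / (π₁ e^{sμ₁+√s W₁} + π₂ e^{sμ₂+√s W₂})] − π₁`,
where `μ₁ = 1/(2π₁)`, `μ₂ = −(1+π₂)/(2π₂²)`, `W₁ ∼ N(0, 1/π₁)` (realized as `w/√π₁`
for `w` standard Gaussian) and `W₂ = −(π₁/π₂)·W₁`. -/
noncomputable def gfun (π1 π2 : ℝ) (s : ℝ) : ℝ :=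
  (∫ w : ℝ,
      (π1 * Real.exp (s * (1 / (2 * π1)) + Real.sqrt s * (w / Real.sqrt π1))) /
        (π1 * Real.exp (s * (1 / (2 * π1)) + Real.sqrt s * (w / Real.sqrt π1)) +
          π2 * Real.exp (s * (-(1 + π2) / (2 * π2 ^ 2)) +
            Real.sqrt s * (-(π1 / π2) * (w / Real.sqrt π1))))
    ∂(ProbabilityTheory.gaussianReal 0 1)) - π1

/-- The first-order Taylor remainder of `(1 + y) ^ d` is dominated by that at `|y|`. -/
lemma abs_one_add_pow_sub_le (y : ℝ) (d : ℕ) :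
    |(1 + y) ^ d - 1 - d * y| ≤ (1 + |y|) ^ d - 1 - d * |y| := by
  induction d with
  | zero => simp
  | succ d ih =>
    have h1 : (1 + y) ^ (d + 1) - 1 - ((d + 1 : ℕ) : ℝ) * y
        = (1 + y) * ((1 + y) ^ d - 1 - d * y) + d * y ^ 2 := by
      push_cast; ring
    have h2 : (1 + |y|) ^ (d + 1) - 1 - ((d + 1 : ℕ) : ℝ) * |y|
        = (1 + |y|) * ((1 + |y|) ^ d - 1 - d * |y|) + d * y ^ 2 := by
      rw [← sq_abs y]; push_cast; ring
    have h3 : |1 + y| ≤ 1 + |y| := by simpa using abs_add_le 1 y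
    rw [h1, h2]
    refine (abs_add_le _ _).trans (add_le_add ?_ (le_of_eq (abs_of_nonneg (by positivity))))
    rw [abs_mul]
    exact mul_le_mul h3 ih (abs_nonneg _) (by positivity)

/-- Quadratic bound on the first-order Taylor remainder of `(1 + y) ^ d`. -/
lemma abs_one_add_pow_sub_le_sq {y s : ℝ} {d : ℕ} (hs : d * |y| ≤ s) (hs1 : s ≤ 1) :
    |(1 + y) ^ d - 1 - d * y| ≤ s ^ 2 := by
  have h0 : 0 ≤ d * |y| := by positivity
  have h1 : (1 + |y|) ^ d ≤ Real.exp (d * |y|) := by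
    rw [Real.exp_nat_mul]
    exact pow_le_pow_left₀ (by positivity) (by linarith [Real.add_one_le_exp |y|]) d
  have h2 := Real.abs_exp_sub_one_sub_id_le (x := d * |y|)
    (by rw [abs_of_nonneg h0]; linarith)
  have h3 := (abs_le.mp h2).2
  have h4 : (d * |y|) ^ 2 ≤ s ^ 2 := pow_le_pow_left₀ h0 hs 2
  linarith [abs_one_add_pow_sub_le y d]

/-- The expectation of a product of functions of independent, identically distributed
coordinates. -/
lemma sum_prod_mul_prod {ι : Type*} [Fintype ι] (m f : ι → ℝ) (d : ℕ) :
    ∑ ω : Fin d → ι, (∏ j, m (ω j)) * ∏ j, f (ω j) = (∑ a, m a * f a) ^ d := by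
  simp_rw [← Finset.prod_mul_distrib]
  have := Finset.sum_prod_piFinset (R := ℝ) (ι := Fin d) (κ := ι) Finset.univ
    (fun _ a => m a * f a)
  simpa using this

/-- Pointwise comparison behind the second-order expansion of the posterior: here `z₁`, `z₂`
are the likelihood ratios of the two root states. -/
lemma abs_posterior_sub_le {p q z₁ z₂ η : ℝ} (hp : 0 < p) (hq : 0 < q)
    (hpq : p + q = 1) (hz₁ : 0 ≤ z₁) (hz₂ : 0 ≤ z₂) (hη : 0 < η) :
    |z₁ * (p * z₁ / (p * z₁ + q * z₂)) -
        (p * ((1 + q) * z₁ - q * z₂) + p * q ^ 2 * (z₁ - z₂) ^ 2)| ≤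
      q / 2 * (η * (z₁ - z₂) ^ 2 + (p * z₁ + q * z₂ - 1) ^ 2 / η) := by
  have hS : 0 ≤ p * z₁ + q * z₂ := by positivity
  rcases hS.eq_or_lt with h0 | hpos
  · have h1 : z₁ = 0 := by nlinarith [mul_nonneg hp.le hz₁, mul_nonneg hq.le hz₂]
    have h2 : z₂ = 0 := by nlinarith [mul_nonneg hp.le hz₁, mul_nonneg hq.le hz₂]
    subst h1 h2
    simp only [mul_zero, sub_self, zero_mul]
    norm_num
    positivity
  obtain rfl : q = 1 - p := by linarith
  set S := p * z₁ + (1 - p) * z₂ with hSdef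
  set D := z₁ - z₂ with hDdef
  have key : z₁ * (p * z₁ / S) -
      (p * ((1 + (1 - p)) * z₁ - (1 - p) * z₂) + p * (1 - p) ^ 2 * D ^ 2)
      = -((1 - p) * ((p * (1 - p) * D / S) * D * (S - 1))) := by
    have hz : z₁ = S + (1 - p) * D := by rw [hSdef, hDdef]; ring
    have hz' : z₂ = S - p * D := by rw [hSdef, hDdef]; ring
    clear_value S D
    subst hz hz'
    field_simp
    ring
  have hratio : |p * (1 - p) * D / S| ≤ 1 := by
    rw [abs_div, abs_of_pos hpos, div_le_one hpos, abs_le]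
    have hp1 : p < 1 := by linarith
    have a1 := mul_nonneg hp.le hz₁
    have a2 := mul_nonneg hq.le hz₂
    constructor
    · nlinarith [mul_nonneg hp.le a2, mul_nonneg hq.le a1]
    · nlinarith [mul_nonneg hp.le a2, mul_nonneg hq.le a1]
  have hamgm : |D| * |S - 1| ≤ 1 / 2 * (η * D ^ 2 + (S - 1) ^ 2 / η) := by
    have : 0 ≤ (η * |D| - |S - 1|) ^ 2 / η := by positivity
    have e : (η * |D| - |S - 1|) ^ 2 / η
        = η * |D| ^ 2 + |S - 1| ^ 2 / η - 2 * (|D| * |S - 1|) := by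
      field_simp; ring
    rw [e, sq_abs, sq_abs] at this
    linarith
  rw [key, abs_neg, abs_mul, abs_of_pos hq, abs_mul, abs_mul]
  calc (1 - p) * (|p * (1 - p) * D / S| * |D| * |S - 1|)
      ≤ (1 - p) * (|D| * |S - 1|) := by
        gcongr
        exact mul_le_of_le_one_left (abs_nonneg _) hratio
    _ ≤ (1 - p) * (1 / 2 * (η * D ^ 2 + (S - 1) ^ 2 / η)) := by gcongr
    _ = _ := by ring

/-- Moments of the likelihood ratio of a product measure, to first order. -/
lemma abs_moment_sub_le {ι : Type*} [Fintype ι] {m h : ι → ℝ} {v : ℝ} (hm1 : ∑ a, m a = 1)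
    (hmh : ∑ a, m a * h a = 0) (hmv : ∑ a, m a * h a ^ 2 = v) {d : ℕ} {θ : ℝ}
    (hd : d * θ ^ 2 ≤ 1) {α β K : ℝ} (hαβ : |α * β| ≤ K) (hv0 : 0 ≤ v) (hv : K * v ≤ 1) :
    |∑ ω : Fin d → ι, (∏ j, m (ω j)) *
        ((∏ j, (1 + θ * α * h (ω j))) * ∏ j, (1 + θ * β * h (ω j)))
        - 1 - d * θ ^ 2 * v * (α * β)| ≤ (K * v) ^ 2 := by
  have h1 : ∑ a, m a * ((1 + θ * α * h a) * (1 + θ * β * h a)) = 1 + θ ^ 2 * v * (α * β) := by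
    have : ∀ a, m a * ((1 + θ * α * h a) * (1 + θ * β * h a))
        = m a + (θ * α + θ * β) * (m a * h a) + θ ^ 2 * (α * β) * (m a * h a ^ 2) := by
      intro a; ring
    simp_rw [this, Finset.sum_add_distrib, ← Finset.mul_sum, hm1, hmh, hmv]
    ring
  simp_rw [← Finset.prod_mul_distrib (f := fun j => 1 + θ * α * _)]
  rw [sum_prod_mul_prod m (fun a => (1 + θ * α * h a) * (1 + θ * β * h a)), h1]
  have := abs_one_add_pow_sub_le_sq (y := θ ^ 2 * v * (α * β)) (s := K * v) (d := d) ?_ hv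
  · rwa [show d * (θ ^ 2 * v * (α * β)) = d * θ ^ 2 * v * (α * β) by ring] at this
  · rw [abs_mul, abs_of_nonneg (by positivity : 0 ≤ θ ^ 2 * v)]
    have hK : 0 ≤ K := (abs_nonneg _).trans hαβ
    calc (d : ℝ) * (θ ^ 2 * v * |α * β|) = (d * θ ^ 2) * (|α * β| * v) := by ring
      _ ≤ 1 * (K * v) := by gcongr
      _ = K * v := one_mul _

/-- One step of the recursion in abstract form: for `d` independent observations with
likelihood ratios `1 + θ h / p` and `1 - θ h / q`, the mean posterior is linear in the
variance `v` of `h`, up to an error that is quadratic but for a factor `η`. -/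
lemma abs_mean_posterior_sub_le {ι : Type*} [Fintype ι] {m h : ι → ℝ} {v : ℝ}
    (hm0 : ∀ a, 0 ≤ m a) (hm1 : ∑ a, m a = 1)
    (hmh : ∑ a, m a * h a = 0) (hmv : ∑ a, m a * h a ^ 2 = v) {d : ℕ} {θ : ℝ}
    (hd : d * θ ^ 2 ≤ 1) {p q η : ℝ} (hp : 0 < p) (hq : 0 < q) (hpq : p + q = 1)
    (h₁ : ∀ a, 0 ≤ 1 + θ * p⁻¹ * h a) (h₂ : ∀ a, 0 ≤ 1 + θ * (-q⁻¹) * h a)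
    (hη : 0 < η) (hv : ((p * q) ^ 2)⁻¹ * v ≤ 1) :
    |∑ ω : Fin d → ι, (∏ j, m (ω j)) * ((∏ j, (1 + θ * p⁻¹ * h (ω j))) *
        (p * (∏ j, (1 + θ * p⁻¹ * h (ω j))) / (p * (∏ j, (1 + θ * p⁻¹ * h (ω j))) +
          q * ∏ j, (1 + θ * (-q⁻¹) * h (ω j))))) - p - d * θ ^ 2 * (v / p)| ≤
      4 * (((p * q) ^ 2)⁻¹ * v) ^ 2 + (η * (5 * (((p * q) ^ 2)⁻¹ * v)) +
        (((p * q) ^ 2)⁻¹ * v) ^ 2 / η) := by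
  set K := ((p * q) ^ 2)⁻¹ with hK
  have hv0 : 0 ≤ v := hmv ▸ Finset.sum_nonneg fun a _ => mul_nonneg (hm0 a) (sq_nonneg _)
  set z₁ : (Fin d → ι) → ℝ := fun ω => ∏ j, (1 + θ * p⁻¹ * h (ω j))
  set z₂ : (Fin d → ι) → ℝ := fun ω => ∏ j, (1 + θ * (-q⁻¹) * h (ω j))
  set w : (Fin d → ι) → ℝ := fun ω => ∏ j, m (ω j) with hw
  have hw0 : ∀ ω, 0 ≤ w ω := fun ω => Finset.prod_nonneg fun j _ => hm0 _
  have hz₁0 : ∀ ω, 0 ≤ z₁ ω := fun ω => Finset.prod_nonneg fun j _ => h₁ _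
  have hz₂0 : ∀ ω, 0 ≤ z₂ ω := fun ω => Finset.prod_nonneg fun j _ => h₂ _
  have hp1 : p ≤ 1 := by linarith
  have hq1 : q ≤ 1 := by linarith
  have hK0 : 0 < K := by positivity
  have hKp : |p⁻¹ * p⁻¹| ≤ K := by
    rw [abs_of_pos (by positivity), hK, ← mul_inv]
    gcongr
    nlinarith [mul_pos hp hp, mul_le_one₀ hq1 hq.le hq1]
  have hKq : |-q⁻¹ * -q⁻¹| ≤ K := by
    rw [neg_mul_neg, abs_of_pos (by positivity), hK, ← mul_inv]
    gcongr
    nlinarith [mul_pos hq hq, mul_le_one₀ hp1 hp.le hp1]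
  have hKpq : |p⁻¹ * -q⁻¹| ≤ K := by
    rw [mul_neg, abs_neg, abs_of_pos (by positivity), hK, ← mul_inv]
    gcongr
    nlinarith [mul_pos hp hq, mul_le_one₀ hp1 hq.le hq1]
  have mean : ∀ α : ℝ, ∑ ω, w ω * ∏ j, (1 + θ * α * h (ω j)) = 1 := by
    intro α
    rw [hw, sum_prod_mul_prod m (fun a => 1 + θ * α * h a)]
    have : ∀ a, m a * (1 + θ * α * h a) = m a + θ * α * (m a * h a) := by intro a; ring
    simp_rw [this, Finset.sum_add_distrib, ← Finset.mul_sum, hm1, hmh]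
    simp
  have mass : ∑ ω, w ω = 1 := by simpa using mean 0
  have e11 := abs_moment_sub_le hm1 hmh hmv hd hKp hv0 hv
  have e22 := abs_moment_sub_le hm1 hmh hmv hd hKq hv0 hv
  have e12 := abs_moment_sub_le hm1 hmh hmv hd hKpq hv0 hv
  have mean₁ : ∑ ω, w ω * z₁ ω = 1 := mean _
  have mean₂ : ∑ ω, w ω * z₂ ω = 1 := mean _
  change |∑ ω, w ω * (z₁ ω * z₁ ω) - 1 - _| ≤ _ at e11
  change |∑ ω, w ω * (z₂ ω * z₂ ω) - 1 - _| ≤ _ at e22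
  change |∑ ω, w ω * (z₁ ω * z₂ ω) - 1 - _| ≤ _ at e12
  change |∑ ω, w ω * (z₁ ω * (p * z₁ ω / (p * z₁ ω + q * z₂ ω))) - p - _| ≤ _
  clear_value z₁ z₂ w
  set A := ∑ ω, w ω * (z₁ ω * z₁ ω)
  set B := ∑ ω, w ω * (z₂ ω * z₂ ω)
  set C := ∑ ω, w ω * (z₁ ω * z₂ ω)
  have sD : ∑ ω, w ω * (z₁ ω - z₂ ω) ^ 2 = A + B - 2 * C := by
    have : ∀ ω, w ω * (z₁ ω - z₂ ω) ^ 2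
        = w ω * (z₁ ω * z₁ ω) + w ω * (z₂ ω * z₂ ω) - 2 * (w ω * (z₁ ω * z₂ ω)) := by
      intro ω; ring
    simp_rw [this, Finset.sum_sub_distrib, Finset.sum_add_distrib, ← Finset.mul_sum]
    rfl
  have sS : ∑ ω, w ω * (p * z₁ ω + q * z₂ ω - 1) ^ 2
      = p ^ 2 * A + q ^ 2 * B + 2 * p * q * C - 1 := by
    have : ∀ ω, w ω * (p * z₁ ω + q * z₂ ω - 1) ^ 2
        = p ^ 2 * (w ω * (z₁ ω * z₁ ω)) + q ^ 2 * (w ω * (z₂ ω * z₂ ω))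
          + 2 * p * q * (w ω * (z₁ ω * z₂ ω)) - 2 * p * (w ω * z₁ ω)
          - 2 * q * (w ω * z₂ ω) + w ω := by
      intro ω; ring
    simp only [this, Finset.sum_sub_distrib, Finset.sum_add_distrib, ← Finset.mul_sum,
      mean₁, mean₂, mass]
    linear_combination (-2) * hpq
  have main : |∑ ω, w ω * (z₁ ω * (p * z₁ ω / (p * z₁ ω + q * z₂ ω)))
      - (p + p * q ^ 2 * (A + B - 2 * C))|
      ≤ q / 2 * (η * (A + B - 2 * C) + (p ^ 2 * A + q ^ 2 * B + 2 * p * q * C - 1) / η) := by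
    have e1 : p + p * q ^ 2 * (A + B - 2 * C) = ∑ ω, w ω *
        (p * ((1 + q) * z₁ ω - q * z₂ ω) + p * q ^ 2 * (z₁ ω - z₂ ω) ^ 2) := by
      have : ∀ ω, w ω * (p * ((1 + q) * z₁ ω - q * z₂ ω) + p * q ^ 2 * (z₁ ω - z₂ ω) ^ 2)
          = p * (1 + q) * (w ω * z₁ ω) - p * q * (w ω * z₂ ω)
            + p * q ^ 2 * (w ω * (z₁ ω - z₂ ω) ^ 2) := by intro ω; ring
      simp_rw [this, Finset.sum_add_distrib, Finset.sum_sub_distrib, ← Finset.mul_sum, sD,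
        mean₁, mean₂]
      ring
    have e2 : q / 2 * (η * (A + B - 2 * C) + (p ^ 2 * A + q ^ 2 * B + 2 * p * q * C - 1) / η)
        = ∑ ω, w ω * (q / 2 * (η * (z₁ ω - z₂ ω) ^ 2 + (p * z₁ ω + q * z₂ ω - 1) ^ 2 / η)) := by
      have : ∀ ω, w ω * (q / 2 * (η * (z₁ ω - z₂ ω) ^ 2 + (p * z₁ ω + q * z₂ ω - 1) ^ 2 / η))
          = q / 2 * η * (w ω * (z₁ ω - z₂ ω) ^ 2)
            + q / 2 / η * (w ω * (p * z₁ ω + q * z₂ ω - 1) ^ 2) := by intro ω; ring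
      simp_rw [this, Finset.sum_add_distrib, ← Finset.mul_sum, sD, sS]
      ring
    rw [e1, e2, ← Finset.sum_sub_distrib]
    refine (Finset.abs_sum_le_sum_abs _ _).trans (Finset.sum_le_sum fun ω _ => ?_)
    rw [← mul_sub, abs_mul, abs_of_nonneg (hw0 ω)]
    exact mul_le_mul_of_nonneg_left
      (abs_posterior_sub_le hp hq hpq (hz₁0 ω) (hz₂0 ω) hη) (hw0 ω)
  set t := (d : ℝ) * θ ^ 2 * v with ht
  have ht0 : 0 ≤ t := by positivity
  have htv : t ≤ v := mul_le_of_le_one_left hv0 hd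
  have hsq : p⁻¹ * p⁻¹ + -q⁻¹ * -q⁻¹ - 2 * (p⁻¹ * -q⁻¹) = K := by
    have : p⁻¹ + q⁻¹ = (p * q)⁻¹ := by field_simp; linarith
    rw [hK, ← inv_pow, ← this]; ring
  have hKv2 : (K * v) ^ 2 ≤ K * v := by nlinarith [mul_nonneg hK0.le hv0]
  have hDbd : |A + B - 2 * C - t * K| ≤ 4 * (K * v) ^ 2 := by
    have htK : t * (p⁻¹ * p⁻¹ + -q⁻¹ * -q⁻¹ - 2 * (p⁻¹ * -q⁻¹)) = t * K := by rw [hsq]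
    rw [abs_le] at e11 e22 e12 ⊢
    constructor <;> linarith [e11.1, e11.2, e22.1, e22.2, e12.1, e12.2]
  have hDle : A + B - 2 * C ≤ 5 * (K * v) := by
    have := (abs_le.mp hDbd).2
    have : t * K ≤ K * v := by rw [mul_comm]; gcongr
    linarith
  have hD0 : 0 ≤ A + B - 2 * C := by
    rw [← sD]; exact Finset.sum_nonneg fun ω _ => mul_nonneg (hw0 ω) (sq_nonneg _)
  have hSle : p ^ 2 * A + q ^ 2 * B + 2 * p * q * C - 1 ≤ (K * v) ^ 2 := by
    have a1 := mul_le_mul_of_nonneg_left (abs_le.mp e11).2 (sq_nonneg p)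
    have a2 := mul_le_mul_of_nonneg_left (abs_le.mp e22).2 (sq_nonneg q)
    have a3 := mul_le_mul_of_nonneg_left (abs_le.mp e12).2 (by positivity : 0 ≤ 2 * p * q)
    have hone : p ^ 2 + q ^ 2 + 2 * p * q = 1 := by
      linear_combination (p + q + 1) * hpq
    have hcancel : p ^ 2 * (t * (p⁻¹ * p⁻¹)) + q ^ 2 * (t * (-q⁻¹ * -q⁻¹))
        + 2 * p * q * (t * (p⁻¹ * -q⁻¹)) = 0 := by
      field_simp; ring
    have e : (p ^ 2 + q ^ 2 + 2 * p * q) * (K * v) ^ 2 = (K * v) ^ 2 := by rw [hone, one_mul]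
    linarith
  have hS0 : 0 ≤ p ^ 2 * A + q ^ 2 * B + 2 * p * q * C - 1 := by
    rw [← sS]; exact Finset.sum_nonneg fun ω _ => mul_nonneg (hw0 ω) (sq_nonneg _)
  have hlin : (d : ℝ) * θ ^ 2 * (v / p) = p * q ^ 2 * (t * K) := by
    rw [hK, ht]; field_simp
  have hbd2 : q / 2 * (η * (A + B - 2 * C)
      + (p ^ 2 * A + q ^ 2 * B + 2 * p * q * C - 1) / η)
      ≤ 1 * (η * (5 * (K * v)) + (K * v) ^ 2 / η) := by
    gcongr
    linarith
  have hbd1 : |p * q ^ 2 * (A + B - 2 * C - t * K)| ≤ 4 * (K * v) ^ 2 := by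
    have hpq1 : p * q ^ 2 ≤ 1 := mul_le_one₀ hp1 (by positivity) (pow_le_one₀ hq.le hq1)
    rw [abs_mul, abs_of_pos (by positivity)]
    exact (mul_le_of_le_one_left (abs_nonneg _) hpq1).trans hDbd
  rw [hlin]
  rw [abs_le] at main hbd1 ⊢
  constructor <;> linarith [main.1, main.2, hbd1.1, hbd1.2]

/-- The likelihood of the edges of a configuration, given the root spin. -/
noncomputable def edgeWeight (M : Fin 2 → Fin 2 → ℝ) {d n : ℕ} (σ : Conf d n) : ℝ :=
  ∏ k : Fin n, ∏ v : Vert d (k + 1), M (σ k.castSucc (v ∘ Fin.castSucc)) (σ k.succ v)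

/-- The conditional probability of the level-`n` spins given the root spin. -/
noncomputable def likelihood (M : Fin 2 → Fin 2 → ℝ) (d n : ℕ) (i : Fin 2)
    (A : LConf d n) : ℝ :=
  ∑ σ : Conf d n, if root σ = i ∧ top σ = A then edgeWeight M σ else 0

/-- A configuration consists of the root spin and the configurations on the subtrees of
the children of the root. -/
def confEquiv (d n : ℕ) : Conf d (n + 1) ≃ Fin 2 × (Fin d → Conf d n) where
  toFun σ := (root σ, fun j k v => σ k.succ (Fin.cons j v))
  invFun x := Fin.cons (α := fun k : Fin (n + 2) => Vert d k → Fin 2) (fun _ => x.1)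
    (fun k (v : Fin (k + 1) → Fin d) => x.2 (v 0) k (fun i => v i.succ))
  left_inv σ := by
    funext k
    refine Fin.cases ?_ (fun k => ?_) k
    · funext v
      exact congrArg (σ 0) (funext fun i => i.elim0)
    · funext v
      exact congrArg (σ k.succ) (Fin.cons_self_tail v)
  right_inv x := rfl

/-- A vertex of level `n + 1` is a child of the root together with a vertex of level `n`
of its subtree. -/
def vertEquiv (d n : ℕ) : Fin d × Vert d n ≃ Vert d (n + 1) :=
  Fin.consEquiv (fun _ => Fin d)

/-- A level-`(n + 1)` configuration is a family of level-`n` configurations indexed by the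
children of the root. -/
def lconfEquiv (d n : ℕ) : LConf d (n + 1) ≃ (Fin d → LConf d n) where
  toFun A j := restrictChild j A
  invFun x v := x (v 0) (fun i => v i.succ)
  left_inv A := by
    funext v
    exact congrArg A (Fin.cons_self_tail v)
  right_inv x := rfl

lemma edgeWeight_succ (M : Fin 2 → Fin 2 → ℝ) {d n : ℕ} (σ : Conf d (n + 1)) :
    edgeWeight M σ = ∏ j, (M (root σ) (root ((confEquiv d n σ).2 j)) *
      edgeWeight M ((confEquiv d n σ).2 j)) := by
  rw [Finset.prod_mul_distrib]
  unfold edgeWeight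
  rw [Fin.prod_univ_succ, Finset.prod_comm]
  congr 1
  · refine ((Fintype.prod_equiv (vertEquiv d 0) _ _ fun x => rfl).symm).trans ?_
    rw [Fintype.prod_prod_type]
    refine Finset.prod_congr rfl fun j _ => ?_
    rw [Fintype.prod_unique]
    refine congrArg₂ M (congrArg (σ 0) (funext fun i => i.elim0)) ?_
    exact congrArg (fun v => σ (Fin.succ 0) (Fin.cons j v)) (funext fun i => i.elim0)
  · refine Finset.prod_congr rfl fun k _ => ?_
    refine ((Fintype.prod_equiv (vertEquiv d (k + 1)) _ _ fun x => rfl).symm).trans ?_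
    rw [Fintype.prod_prod_type]
    refine Finset.prod_congr rfl fun j _ => Finset.prod_congr rfl fun v _ => ?_
    refine congrArg₂ M (congrArg (σ k.succ.castSucc) ?_) rfl
    funext i
    refine Fin.cases rfl (fun i => rfl) i

lemma top_eq_iff {d n : ℕ} (σ : Conf d (n + 1)) (A : LConf d (n + 1)) :
    top σ = A ↔ ∀ j, top ((confEquiv d n σ).2 j) = restrictChild j A := by
  rw [← (lconfEquiv d n).injective.eq_iff, funext_iff]
  rfl

/-- Given the root spin, the subtrees of its children are independent. -/
lemma likelihood_succ (M : Fin 2 → Fin 2 → ℝ) {d n : ℕ} (i : Fin 2) (A : LConf d (n + 1)) :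
    likelihood M d (n + 1) i A =
      ∏ j, ∑ k, M i k * likelihood M d n k (restrictChild j A) := by
  have h1 : ∀ B : LConf d n, ∑ k, M i k * likelihood M d n k B
      = ∑ τ : Conf d n, if top τ = B then M i (root τ) * edgeWeight M τ else 0 := by
    intro B
    simp_rw [likelihood, Finset.mul_sum]
    rw [Finset.sum_comm]
    refine Finset.sum_congr rfl fun τ _ => ?_
    rw [Finset.sum_eq_single (root τ)]
    · simp
    · intro k _ hk
      simp [hk.symm]
    · simp
  simp_rw [h1]
  rw [Finset.prod_univ_sum, Fintype.piFinset_univ, likelihood]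
  rw [Fintype.sum_equiv (confEquiv d n) _ (fun x : Fin 2 × (Fin d → Conf d n) =>
    if x.1 = i then ∏ j, (if top (x.2 j) = restrictChild j A then
      M i (root (x.2 j)) * edgeWeight M (x.2 j) else 0) else 0)]
  · rw [Fintype.sum_prod_type, Finset.sum_eq_single i]
    · simp
    · intro k _ hk
      simp [hk]
    · simp
  · intro σ
    have hr : (confEquiv d n σ).1 = root σ := rfl
    rw [hr, Fintype.prod_ite_zero]
    by_cases h : root σ = i
    · simp only [h, true_and, if_true, edgeWeight_succ, top_eq_iff]
      congr
    · simp only [h, false_and, if_false]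

lemma likelihood_nonneg {M : Fin 2 → Fin 2 → ℝ} (hM : ∀ i j, 0 ≤ M i j) (d n : ℕ) (i : Fin 2)
    (A : LConf d n) : 0 ≤ likelihood M d n i A := by
  refine Finset.sum_nonneg fun σ _ => ?_
  split_ifs
  · exact Finset.prod_nonneg fun k _ => Finset.prod_nonneg fun v _ => hM _ _
  · exact le_rfl

lemma sum_likelihood {M : Fin 2 → Fin 2 → ℝ} (hM : ∀ i, ∑ j, M i j = 1) (d n : ℕ)
    (i : Fin 2) : ∑ A, likelihood M d n i A = 1 := by
  induction n generalizing i with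
  | zero =>
    simp_rw [likelihood]
    rw [Finset.sum_comm]
    have h1 : ∀ σ : Conf d 0, (∑ A, if root σ = i ∧ top σ = A then edgeWeight M σ else 0)
        = if root σ = i then 1 else 0 := by
      intro σ
      simp [ite_and, edgeWeight]
    simp_rw [h1]
    rw [Finset.sum_eq_single (fun _ _ => i)]
    · simp [root]
    · intro σ _ hσ
      rw [if_neg]
      rintro rfl
      refine hσ (funext fun k => funext fun v => ?_)
      obtain rfl : k = 0 := Subsingleton.elim (α := Fin 1) _ _
      exact congrArg (σ 0) (funext fun i => i.elim0)
    · simp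
  | succ n ih =>
    simp_rw [likelihood_succ]
    refine (Fintype.sum_equiv (lconfEquiv d n) _ (fun x : Fin d → LConf d n =>
      ∏ j, ∑ k, M i k * likelihood M d n k (x j)) fun A => rfl).trans ?_
    have := sum_prod_mul_prod (fun _ : LConf d n => (1 : ℝ))
      (fun B => ∑ k, M i k * likelihood M d n k B) d
    simp only [Finset.prod_const_one, one_mul] at this
    rw [this, Finset.sum_comm]
    simp_rw [← Finset.mul_sum, ih, mul_one, hM, one_pow]

lemma pst_zero {θ p q : ℝ} (hpq : p + q = 1) (hθ : θ ≠ 1) : pst θ (Dlt θ p q) 0 = p := by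
  have : 1 - θ ≠ 0 := sub_ne_zero.mpr hθ.symm
  simp only [pst, Dlt, if_true]
  field_simp
  linear_combination -hpq

lemma pst_one {θ p q : ℝ} (hpq : p + q = 1) (hθ : θ ≠ 1) : pst θ (Dlt θ p q) 1 = q := by
  have : 1 - θ ≠ 0 := sub_ne_zero.mpr hθ.symm
  simp only [pst, Dlt, if_false, one_ne_zero]
  field_simp
  linear_combination -hpq

lemma jointProb_eq (d : ℕ) (θ Δ : ℝ) (n : ℕ) (i : Fin 2) (A : LConf d n) :
    jointProb d θ Δ n i A = pst θ Δ i * likelihood (Mmat θ Δ) d n i A := by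
  rw [jointProb, likelihood, Finset.mul_sum]
  refine Finset.sum_congr rfl fun σ _ => ?_
  split_ifs with h
  · rw [← h.1]; rfl
  · simp

lemma levelProb_eq (d : ℕ) (θ Δ : ℝ) (n : ℕ) (A : LConf d n) :
    levelProb d θ Δ n A = pst θ Δ 0 * likelihood (Mmat θ Δ) d n 0 A +
      pst θ Δ 1 * likelihood (Mmat θ Δ) d n 1 A := by
  rw [← jointProb_eq, ← jointProb_eq, jointProb, jointProb, ← Finset.sum_add_distrib, levelProb]
  refine Finset.sum_congr rfl fun σ _ => ?_
  rcases Fin.exists_fin_two.mp ⟨root σ, rfl⟩ with h | h <;> simp [h]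

lemma xseq_eq {p q θ : ℝ} (hpq : p + q = 1) (hp : 0 < p) (hθ : θ ≠ 1) (d n : ℕ) :
    xseq d θ (Dlt θ p q) n = ∑ A, likelihood (Mmat θ (Dlt θ p q)) d n 0 A *
      (p * likelihood (Mmat θ (Dlt θ p q)) d n 0 A /
        (p * likelihood (Mmat θ (Dlt θ p q)) d n 0 A +
          q * likelihood (Mmat θ (Dlt θ p q)) d n 1 A)) - p := by
  simp only [xseq, expect1, condLevel, post, jointProb_eq, levelProb_eq, pst_zero hpq hθ,
    pst_one hpq hθ]
  congr 1
  refine Finset.sum_congr rfl fun A _ => ?_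
  rw [mul_div_cancel_left₀ _ hp.ne']

/-- The bias `x_n` is, up to the factor `1 / π₁`, the variance of the posterior, and it is
approximately multiplied by `d θ²` from one level to the next. -/
lemma exists_variance_bound {p q θ : ℝ} {d : ℕ} (hpq : p + q = 1) (hp : 0 < p) (hq : 0 < q)
    (hθ : θ ≠ 1) (hM : ∀ i j, 0 ≤ Mmat θ (Dlt θ p q) i j) (hd : (d : ℝ) * θ ^ 2 ≤ 1) (n : ℕ) :
    ∃ v : ℝ, 0 ≤ v ∧ xseq d θ (Dlt θ p q) n = v / p ∧
      ∀ η : ℝ, 0 < η → ((p * q) ^ 2)⁻¹ * v ≤ 1 →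
        |xseq d θ (Dlt θ p q) (n + 1) - (d : ℝ) * θ ^ 2 * xseq d θ (Dlt θ p q) n| ≤
          4 * (((p * q) ^ 2)⁻¹ * v) ^ 2 + (η * (5 * (((p * q) ^ 2)⁻¹ * v)) +
            (((p * q) ^ 2)⁻¹ * v) ^ 2 / η) := by
  rw [xseq_eq hpq hp hθ d n, xseq_eq hpq hp hθ d (n + 1)]
  have hsucc := likelihood_succ (Mmat θ (Dlt θ p q)) (d := d) (n := n)
  obtain ⟨h00, h01, h10, h11⟩ : Mmat θ (Dlt θ p q) 0 0 = p + θ * q ∧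
      Mmat θ (Dlt θ p q) 0 1 = q * (1 - θ) ∧ Mmat θ (Dlt θ p q) 1 0 = p * (1 - θ) ∧
      Mmat θ (Dlt θ p q) 1 1 = q + θ * p := by
    obtain rfl : q = 1 - p := by linarith
    simp only [Mmat, Dlt, if_true, if_false, one_ne_zero]
    refine ⟨?_, ?_, ?_, ?_⟩ <;> ring
  have hrow : ∀ i, ∑ j, Mmat θ (Dlt θ p q) i j = 1 := by
    intro i
    rw [Fin.sum_univ_two]
    fin_cases i
    · simp only [Fin.zero_eta, h00, h01]; linear_combination hpq
    · simp only [Fin.mk_one, h10, h11]; linear_combination hpq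
  have hnn := likelihood_nonneg hM d n
  have hsum := sum_likelihood hrow d n
  have m00 := hM 0 0
  have m01 := hM 0 1
  have m10 := hM 1 0
  have m11 := hM 1 1
  rw [h00] at m00
  rw [h01] at m01
  rw [h10] at m10
  rw [h11] at m11
  simp only [Fin.sum_univ_two] at hsucc
  generalize hL : likelihood (Mmat θ (Dlt θ p q)) d n = L at *
  generalize hL' : likelihood (Mmat θ (Dlt θ p q)) d (n + 1) = L' at *
  set m : LConf d n → ℝ := fun A => p * L 0 A + q * L 1 A with hm
  set h : LConf d n → ℝ := fun A => p * L 0 A / m A - p with hh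
  have hm0 : ∀ A, 0 ≤ m A := fun A =>
    add_nonneg (mul_nonneg hp.le (hnn 0 A)) (mul_nonneg hq.le (hnn 1 A))
  have hpost : ∀ A, m A * (p + h A) = p * L 0 A := by
    intro A
    simp only [hh, add_sub_cancel]
    refine mul_div_cancel_of_imp' fun h0 => ?_
    have a := mul_nonneg hp.le (hnn 0 A)
    have b := mul_nonneg hq.le (hnn 1 A)
    simp only [hm] at h0
    linarith
  have hX0 : ∀ A, 0 ≤ p + h A := fun A => by
    simp only [hh, add_sub_cancel]
    exact div_nonneg (mul_nonneg hp.le (hnn 0 A)) (hm0 A)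
  have hX1 : ∀ A, p + h A ≤ 1 := fun A => by
    simp only [hh, add_sub_cancel]
    exact div_le_one_of_le₀ (le_add_of_nonneg_right (mul_nonneg hq.le (hnn 1 A))) (hm0 A)
  have hL0 : ∀ A, L 0 A = m A * (1 + p⁻¹ * h A) := fun A => by
    have := hpost A
    field_simp
    linarith
  have hL1 : ∀ A, L 1 A = m A * (1 - q⁻¹ * h A) := fun A => by
    have h1 := hpost A
    have h2 : m A = p * L 0 A + q * L 1 A := rfl
    field_simp
    linear_combination (-1 : ℝ) * h2 + h1 - m A * hpq
  have hm1 : ∑ A, m A = 1 := by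
    simp only [hm, Finset.sum_add_distrib, ← Finset.mul_sum, hsum]
    linarith
  have hmh : ∑ A, m A * h A = 0 := by
    have : ∀ A, m A * h A = p * L 0 A - p * m A := fun A => by
      rw [← hpost]; ring
    simp only [this, Finset.sum_sub_distrib, ← Finset.mul_sum, hsum, hm1, sub_self]
  have hvar : ∑ A, L 0 A * (p * L 0 A / (p * L 0 A + q * L 1 A)) - p
      = (∑ A, m A * h A ^ 2) / p := by
    have : ∀ A, L 0 A * (p * L 0 A / (p * L 0 A + q * L 1 A))
        = p * m A + 2 * (m A * h A) + p⁻¹ * (m A * h A ^ 2) := by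
      intro A
      have e : p * L 0 A / (p * L 0 A + q * L 1 A) = p + h A := by
        simp only [hh, hm, add_sub_cancel]
      rw [e, hL0]
      field_simp
      ring
    simp only [this, Finset.sum_add_distrib, ← Finset.mul_sum, hm1, hmh]
    ring
  refine ⟨∑ A, m A * h A ^ 2, Finset.sum_nonneg fun A _ => mul_nonneg (hm0 A) (sq_nonneg _),
    hvar, fun η hη hKv => ?_⟩
  have hf₁ : ∀ A, 0 ≤ 1 + θ * p⁻¹ * h A := fun A => by
    have e : 1 + θ * p⁻¹ * h A
        = (p + h A) * ((p + θ * q) / p) + (1 - (p + h A)) * (q * (1 - θ) / q) := by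
      field_simp
      linear_combination (-θ * (p + h A)) * hpq
    rw [e]
    exact add_nonneg (mul_nonneg (hX0 A) (div_nonneg m00 hp.le))
      (mul_nonneg (sub_nonneg.mpr (hX1 A)) (div_nonneg m01 hq.le))
  have hf₂ : ∀ A, 0 ≤ 1 + θ * (-q⁻¹) * h A := fun A => by
    have e : 1 + θ * (-q⁻¹) * h A
        = (p + h A) * (p * (1 - θ) / p) + (1 - (p + h A)) * ((q + θ * p) / q) := by
      field_simp
      linear_combination (θ * (p + h A)) * hpq
    rw [e]
    exact add_nonneg (mul_nonneg (hX0 A) (div_nonneg m10 hp.le))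
      (mul_nonneg (sub_nonneg.mpr (hX1 A)) (div_nonneg m11 hq.le))
  have hmain := abs_mean_posterior_sub_le hm0 hm1 hmh rfl hd hp hq hpq hf₁ hf₂ hη hKv
  rw [hvar]
  convert hmain using 4
  refine Fintype.sum_equiv (lconfEquiv d n) _ _ fun A => ?_
  have e₀ : L' 0 A = (∏ j, m (lconfEquiv d n A j)) *
      ∏ j, (1 + θ * p⁻¹ * h (lconfEquiv d n A j)) := by
    rw [hsucc, ← Finset.prod_mul_distrib]
    refine Finset.prod_congr rfl fun j _ => ?_
    change _ = m (restrictChild j A) * (1 + θ * p⁻¹ * h (restrictChild j A))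
    rw [h00, h01, hL0, hL1]
    field_simp
    linear_combination (m (restrictChild j A) * (p + θ * h (restrictChild j A))) * hpq
  have e₁ : L' 1 A = (∏ j, m (lconfEquiv d n A j)) *
      ∏ j, (1 + θ * (-q⁻¹) * h (lconfEquiv d n A j)) := by
    rw [hsucc, ← Finset.prod_mul_distrib]
    refine Finset.prod_congr rfl fun j _ => ?_
    change _ = m (restrictChild j A) * (1 + θ * (-q⁻¹) * h (restrictChild j A))
    rw [h10, h11, hL0, hL1]
    field_simp
    linear_combination (m (restrictChild j A) * (q - θ * h (restrictChild j A))) * hpq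
  rw [e₀, e₁, mul_left_comm p, mul_left_comm q, ← mul_add, mul_assoc]
  rcases eq_or_ne (∏ j, m (lconfEquiv d n A j)) 0 with hw | hw
  · simp [hw]
  · rw [mul_div_mul_left _ _ hw]

/-- Assuming `dθ² ≤ 1`, for any `ε > 0` there is a `δ = δ(π, ε) > 0`
such that for all `n`, if `x_n < δ` then `|x_{n+1} − dθ²x_n| ≤ ε x_n`. -/
theorem xseq_linear_approx (π1 π2 : ℝ) (hsum : π1 + π2 = 1) (hord : π2 ≤ π1)
    (hpi2 : 0 < π2) :
    ∀ ε : ℝ, 0 < ε → ∃ δ : ℝ, 0 < δ ∧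
      ∀ d : ℕ, 2 ≤ d → ∀ θ : ℝ, θ ≠ 0 →
        (∀ i j, 0 < Mmat θ (Dlt θ π1 π2) i j) → (d : ℝ) * θ ^ 2 ≤ 1 →
        ∀ n : ℕ, xseq d θ (Dlt θ π1 π2) n < δ →
          |xseq d θ (Dlt θ π1 π2) (n + 1) - (d : ℝ) * θ ^ 2 * xseq d θ (Dlt θ π1 π2) n| ≤
            ε * xseq d θ (Dlt θ π1 π2) n := by
  intro ε hε
  have hpi1 : 0 < π1 := hpi2.trans_le hord
  set K := ((π1 * π2) ^ 2)⁻¹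
  have hK0 : 0 < K := by positivity
  set e := ε / (K * π1) with he
  have he0 : 0 < e := by positivity
  refine ⟨min 1 (min (e / 12) (e ^ 2 / 45)) / (K * π1), by positivity, ?_⟩
  intro d _ θ _ hM hd n hx
  have hθ : θ < 1 := by
    have a := hM 0 1
    have b := hM 1 0
    simp only [Mmat, if_true, if_false, one_ne_zero] at a b
    linarith
  obtain ⟨v, hv0, hxv, hstep⟩ := exists_variance_bound hsum hpi1 hpi2 hθ.ne
    (fun i j => (hM i j).le) hd n
  set x := xseq d θ (Dlt θ π1 π2) n
  have hv : v = π1 * x := by rw [hxv]; field_simp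
  have hx0 : 0 ≤ x := by rw [hxv]; positivity
  set u := K * v with hu
  have hux : u = x * (K * π1) := by rw [hu, hv]; ring
  have hu0 : 0 ≤ u := by positivity
  have hlt : u < min 1 (min (e / 12) (e ^ 2 / 45)) := by
    rw [hux]; exact (lt_div_iff₀ (by positivity)).mp hx
  obtain ⟨hlt1, hlt2, hlt3⟩ : u < 1 ∧ u < e / 12 ∧ u < e ^ 2 / 45 := by
    simpa only [lt_min_iff] using hlt
  refine (hstep (e / 15) (by positivity) hlt1.le).trans ?_
  have hεu : ε * x = e * u := by rw [hux, he]; field_simp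
  have h1 : u ^ 2 / (e / 15) ≤ e / 3 * u := by
    rw [div_le_iff₀ (by positivity)]
    nlinarith
  rw [hεu]
  nlinarith

end AsymIsing
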